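/- arXiv:2201.09103 — 7 statements merged into one kernel-verified Lean document; each statement's English description precedes it below -/
import Mathlib

section
/- Let 0 < β ≤ 1 and define δ(ξ) = (1-ξ)^β · ((1+β/2) - (β/2)ξ) using principal complex powers. Then, as real x → 0 from the right, x^{-β} · δ(e^{-x}) = 1 + O(x²); that is, the function x ↦ x^{-β} δ(e^{-x}) - 1 is O(x²) as x → 0⁺. -/
open Real Asymptotics

/-- A quantitative second-order bound for the real power near `1`. -/
lemma abs_one_add_rpow_sub_le {β t : ℝ} (hβ0 : 0 ≤ β) (hβ1 : β ≤ 1) (ht : -(1 / 2) ≤ t) :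
    |(1 + t) ^ β - (1 + β * t)| ≤ 2 * t ^ 2 := by
  have hpos : 0 < 1 + t := by linarith
  have upper : (1 + t) ^ β ≤ 1 + β * t :=
    rpow_one_add_le_one_add_mul_self (by linarith) hβ0 hβ1
  have hexp : 1 + β * Real.log (1 + t) ≤ (1 + t) ^ β := by
    rw [rpow_def_of_pos hpos]
    linarith [add_one_le_exp (Real.log (1 + t) * β)]
  have hlog : t - 2 * t ^ 2 ≤ Real.log (1 + t) := by
    refine le_trans ?_ (one_sub_inv_le_log_of_pos hpos)
    have h : 1 - (1 + t)⁻¹ - (t - 2 * t ^ 2) = t ^ 2 * (1 + 2 * t) / (1 + t) := by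
      field_simp
      ring
    have : 0 ≤ t ^ 2 * (1 + 2 * t) / (1 + t) :=
      div_nonneg (mul_nonneg (sq_nonneg t) (by linarith)) hpos.le
    linarith
  rw [abs_le]
  constructor
  · nlinarith [mul_le_mul_of_nonneg_left hlog hβ0, sq_nonneg t]
  · nlinarith [sq_nonneg t]

/-- The second-order expansion of `(1 - exp (-x)) / x` on `(0, 1]`. -/
lemma abs_one_sub_exp_neg_div_sub_le {x : ℝ} (hx0 : 0 < x) (hx1 : x ≤ 1) :
    |(1 - Real.exp (-x)) / x - 1 + x / 2| ≤ x ^ 2 / 4 := by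
  have h := Real.exp_bound (x := -x) (by rw [abs_neg, abs_of_pos hx0]; exact hx1)
    (n := 3) (by norm_num)
  rw [abs_neg, abs_of_pos hx0] at h
  norm_num [Finset.sum_range_succ, Nat.factorial] at h
  have e : (1 - Real.exp (-x)) / x - 1 + x / 2 =
      -(Real.exp (-x) - (1 + -x + x ^ 2 / 2)) / x := by
    field_simp
    ring
  rw [e, abs_div, abs_neg, abs_of_pos hx0, div_le_iff₀ hx0]
  nlinarith [pow_pos hx0 3]

/-- The symbol of the method is consistent of order two, with an explicit constant. -/
lemma abs_rpow_mul_sub_one_le {β x : ℝ} (hβ0 : 0 ≤ β) (hβ1 : β ≤ 1) (hx0 : 0 < x)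
    (hx1 : x ≤ 1 / 2) :
    |x ^ (-β) * ((1 - Real.exp (-x)) ^ β * ((1 + β / 2) - β / 2 * Real.exp (-x))) - 1|
      ≤ 10 * x ^ 2 := by
  have hu := abs_one_sub_exp_neg_div_sub_le hx0 (by linarith)
  obtain ⟨t, ht⟩ : ∃ t, t = (1 - Real.exp (-x)) / x - 1 := ⟨_, rfl⟩
  rw [← ht] at hu
  have hw : 1 - Real.exp (-x) = x * (1 + t) := by
    rw [ht]
    field_simp
    ring
  have hu' := abs_le.mp hu
  have htl : -x ≤ t := by nlinarith
  have htu : t ≤ 0 := by nlinarith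
  have hs := abs_one_add_rpow_sub_le hβ0 hβ1 (t := t) (by linarith)
  obtain ⟨s, hs'⟩ : ∃ s, s = (1 + t) ^ β - (1 + β * t) := ⟨_, rfl⟩
  rw [← hs'] at hs
  have hexp : Real.exp (-x) = 1 - x * (1 + t) := by linarith
  have hxx : x ^ (-β) * x ^ β = 1 := by
    rw [← rpow_add hx0]
    simp
  have e : x ^ (-β) * ((1 - Real.exp (-x)) ^ β * ((1 + β / 2) - β / 2 * Real.exp (-x))) - 1 =
      β * (t + x / 2) + s * (1 + β * x / 2 * (1 + t)) + β * (x * t) / 2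
        + β * (x * t) * (β * (1 + t)) / 2 := by
    rw [hw, mul_rpow hx0.le (by linarith), hexp, hs']
    linear_combination (1 + t) ^ β * (1 + β / 2 * x * (1 + t)) * hxx
  have htabs : |t| ≤ x := abs_le.mpr ⟨htl, by linarith⟩
  have ht2 : t ^ 2 ≤ x ^ 2 := sq_le_sq' htl (by linarith)
  have hβ : |β| ≤ 1 := by rwa [abs_of_nonneg hβ0]
  have h1t : |1 + t| ≤ 1 := abs_le.mpr ⟨by linarith, by linarith⟩
  have b1 : |β * (t + x / 2)| ≤ 1 * (x ^ 2 / 4) := by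
    rw [abs_mul]
    gcongr
  have b0 : |β * x / 2 * (1 + t)| ≤ 1 := by
    rw [abs_mul, abs_div, abs_mul, abs_of_pos hx0, abs_two]
    have : |β| * x ≤ 1 * 1 := mul_le_mul hβ (by linarith) hx0.le zero_le_one
    exact mul_le_one₀ (by linarith) (abs_nonneg _) h1t
  have b2 : |s * (1 + β * x / 2 * (1 + t))| ≤ (2 * x ^ 2) * 2 := by
    rw [abs_mul]
    have := abs_le.mp b0
    exact mul_le_mul (by linarith) (abs_le.mpr ⟨by linarith, by linarith⟩) (abs_nonneg _)
      (by positivity)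
  have b3 : |β * (x * t)| ≤ 1 * (x * x) := by
    rw [abs_mul, abs_mul, abs_of_pos hx0]
    gcongr
  have b4 : |β * (x * t) * (β * (1 + t))| ≤ (1 * (x * x)) * (1 * 1) := by
    rw [abs_mul, abs_mul β (1 + t)]
    gcongr
  rw [e]
  rw [abs_le] at b1 b2 b3 b4 ⊢
  constructor <;> nlinarith [sq_nonneg x]

theorem stmt_1 (β : ℝ) (hβ0 : 0 < β) (hβ1 : β ≤ 1) :
    (fun x : ℝ =>
        ((x ^ (-β) : ℝ) : ℂ) *
          ((1 - Complex.exp (-(x : ℂ))) ^ (β : ℂ) *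
            (((1 + β / 2 : ℝ) : ℂ) - ((β / 2 : ℝ) : ℂ) * Complex.exp (-(x : ℂ)))) - 1)
      =O[nhdsWithin 0 (Set.Ioi 0)] (fun x : ℝ => x ^ 2) := by
  refine IsBigO.of_bound 10 ?_
  filter_upwards [Ioc_mem_nhdsGT (show (0 : ℝ) < 1 / 2 by norm_num)] with x hx
  have hw : 0 ≤ 1 - Real.exp (-x) := by
    linarith [Real.exp_le_one_iff.mpr (neg_nonpos.mpr hx.1.le)]
  have e : ((x ^ (-β) : ℝ) : ℂ) *
          ((1 - Complex.exp (-(x : ℂ))) ^ (β : ℂ) *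
            (((1 + β / 2 : ℝ) : ℂ) - ((β / 2 : ℝ) : ℂ) * Complex.exp (-(x : ℂ)))) - 1 =
      ((x ^ (-β) * ((1 - Real.exp (-x)) ^ β *
        ((1 + β / 2) - β / 2 * Real.exp (-x))) - 1 : ℝ) : ℂ) := by
    simp only [Complex.ofReal_sub, Complex.ofReal_mul, Complex.ofReal_cpow hw,
      Complex.ofReal_exp, Complex.ofReal_neg, Complex.ofReal_one]
  rw [e, Complex.norm_real, Real.norm_eq_abs, Real.norm_eq_abs, abs_of_nonneg (sq_nonneg x)]
  exact abs_rpow_mul_sub_one_le hβ0.le hβ1 hx.1 hx.2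
end

section
/- Let 0 < β ≤ 1 and define δ(ξ) = (1-ξ)^β · ((1+β/2) - (β/2)ξ) using principal complex powers. Then, as real x → 0 from the right, x^{-β} · δ(e^{-x}) = 1 - (β(3β+5)/24) x² + O(x³); that is, the function x ↦ x^{-β} δ(e^{-x}) - 1 + (β(3β+5)/24) x² is O(x³) as x → 0⁺. -/
open Real Asymptotics

theorem one_add_rpow_sub_quadratic_isBigO (β : ℝ) :
    (fun u : ℝ => (1 + u) ^ β - (1 + β * u + β * (β - 1) / 2 * u ^ 2)) =O[nhds 0]
      (fun u : ℝ => u ^ 3) := by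
  have h := (Real.one_add_rpow_hasFPowerSeriesAt_zero (a := β)).isBigO_sub_partialSum_pow 3
  refine (h.congr_left fun u => ?_).trans (IsBigO.of_bound 1 (by simp))
  have h2 : Ring.choose β 2 = β * (β - 1) / 2 := by
    simp [Ring.choose_eq_smul, descPochhammer_succ_right, Polynomial.smeval_mul]
    ring
  simp [FormalMultilinearSeries.partialSum, Finset.sum_range_succ, binomialSeries_apply, h2,
    -FormalMultilinearSeries.apply_eq_prod_smul_coeff]

theorem div_pow_isBigO_one {f : ℝ → ℝ} {n : ℕ}
    (h : f =O[nhdsWithin 0 (Set.Ioi 0)] (fun x : ℝ => x ^ n)) :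
    (fun x => f x / x ^ n) =O[nhdsWithin 0 (Set.Ioi 0)] (fun _ => (1 : ℝ)) := by
  refine (h.mul (isBigO_refl (fun x : ℝ => (x ^ n)⁻¹) _)).congr' ?_ ?_
  · exact .of_forall fun x => (div_eq_mul_inv _ _).symm
  · filter_upwards [self_mem_nhdsWithin] with x hx
    exact mul_inv_cancel₀ (pow_ne_zero n (ne_of_gt hx))

theorem one_sub_exp_neg_div_sub_isBigO :
    (fun x : ℝ => (1 - exp (-x)) / x - 1 + x / 2 - x ^ 2 / 6)
      =O[nhdsWithin 0 (Set.Ioi 0)] (fun x : ℝ => x ^ 3) := by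
  have hneg : Filter.Tendsto (fun x : ℝ => -x) (nhdsWithin 0 (Set.Ioi 0)) (nhds 0) :=
    (continuous_neg.tendsto' 0 0 neg_zero).mono_left nhdsWithin_le_nhds
  have h := (Real.exp_sub_sum_range_isBigO_pow 4).comp_tendsto hneg
  refine (h.neg_left.mul (isBigO_refl (fun x : ℝ => x⁻¹) _)).congr' ?_ ?_
  · filter_upwards [self_mem_nhdsWithin] with x hx
    have hx0 : x ≠ 0 := ne_of_gt hx
    simp [Finset.sum_range_succ, Nat.factorial]
    field_simp
    ring
  · filter_upwards [self_mem_nhdsWithin] with x hx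
    have hx0 : x ≠ 0 := ne_of_gt hx
    simp only [Function.comp_apply]
    field_simp

theorem rpow_neg_mul_generating_function_isBigO (β : ℝ) :
    (fun x : ℝ => ((1 - exp (-x)) / x) ^ β * ((1 + β / 2) - β / 2 * exp (-x)) - 1
        + β * (3 * β + 5) / 24 * x ^ 2)
      =O[nhdsWithin 0 (Set.Ioi 0)] (fun x : ℝ => x ^ 3) := by
  set l := nhdsWithin (0 : ℝ) (Set.Ioi 0)
  set u : ℝ → ℝ := fun x => (1 - exp (-x)) / x - 1
  have hid : Filter.Tendsto (fun x : ℝ => x) l (nhds 0) := nhdsWithin_le_nhds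
  have hx1 : (fun x : ℝ => x) =O[l] (fun _ => (1 : ℝ)) := hid.isBigO_one ℝ
  have hmul {f g : ℝ → ℝ} (hf : f =O[l] (fun _ => (1 : ℝ))) (hg : g =O[l] (fun _ => (1 : ℝ))) :
      (fun x => f x * g x) =O[l] (fun _ => (1 : ℝ)) := by simpa using hf.mul hg
  have hc (c : ℝ) : (fun _ : ℝ => c) =O[l] (fun _ => (1 : ℝ)) := isBigO_const_const c one_ne_zero l
  set w : ℝ → ℝ := fun x => (u x + x / 2 - x ^ 2 / 6) / x ^ 3
  have hw : w =O[l] (fun _ => (1 : ℝ)) := div_pow_isBigO_one one_sub_exp_neg_div_sub_isBigO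
  set a : ℝ → ℝ := fun x => 1 / 6 + x * w x
  have ha : a =O[l] (fun _ => (1 : ℝ)) := (hc _).add (hmul hx1 hw)
  set v : ℝ → ℝ := fun x => -1 / 2 + x * a x
  have hv : v =O[l] (fun _ => (1 : ℝ)) := (hc _).add (hmul hx1 ha)
  have huv : ∀ᶠ x in l, u x = x * v x := by
    filter_upwards [self_mem_nhdsWithin] with x hx
    have hx0 : x ≠ 0 := ne_of_gt hx
    simp only [v, a, w]
    field_simp
    ring
  have hux : u =O[l] (fun x : ℝ => x) :=
    (((isBigO_refl (fun x : ℝ => x) l).mul hv).congr' (huv.mono fun x hx => hx.symm)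
      (.of_forall fun x => mul_one x))
  have hu0 : Filter.Tendsto u l (nhds 0) := hux.trans_tendsto hid
  have hu1 : u =O[l] (fun _ => (1 : ℝ)) := hu0.isBigO_one ℝ
  set z : ℝ → ℝ := fun x =>
    ((1 + u x) ^ β - (1 + β * u x + β * (β - 1) / 2 * u x ^ 2)) / x ^ 3
  have hz : z =O[l] (fun _ => (1 : ℝ)) := div_pow_isBigO_one
    (((one_add_rpow_sub_quadratic_isBigO β).comp_tendsto hu0).trans (hux.pow 3))
  have hF : (fun x => 1 + β / 2 * (x * (1 + u x))) =O[l] (fun _ => (1 : ℝ)) :=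
    (hc 1).add (hmul (hc _) (hmul hx1 ((hc 1).add hu1)))
  have hvv := hmul hv hv
  have hG : (fun x => z x * (1 + β / 2 * (x * (1 + u x))) + (β * w x
      + β * (β - 1) / 2 * (-1 * a x + x * (a x * a x)) + (β + β ^ 2) / 2 * a x
      + β ^ 2 / 2 * (v x * v x) + β * (β - 1) / 2 * (β / 2) * ((v x * v x) * (1 + u x))))
      =O[l] (fun _ => (1 : ℝ)) :=
    (hmul hz hF).add (((((hmul (hc _) hw).add
      (hmul (hc _) ((hmul (hc _) ha).add (hmul hx1 (hmul ha ha))))).add (hmul (hc _) ha)).add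
      (hmul (hc _) hvv)).add (hmul (hc _) (hmul hvv ((hc 1).add hu1))))
  refine ((isBigO_refl (fun x : ℝ => x ^ 3) l).mul hG).congr' ?_ (.of_forall fun x => mul_one _)
  filter_upwards [self_mem_nhdsWithin, huv] with x hx hux
  have hx0 : x ≠ 0 := ne_of_gt hx
  have hs : (1 - exp (-x)) / x = 1 + u x := by simp [u]
  have he : exp (-x) = 1 - x * (1 + u x) := by rw [← hs]; field_simp; ring
  have hP : (1 + u x) ^ β = 1 + β * u x + β * (β - 1) / 2 * u x ^ 2 + x ^ 3 * z x := by
    simp only [z]; field_simp; ring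
  rw [hs, he, hP, hux]
  simp only [v, a]
  ring

theorem stmt_2 (β : ℝ) (hβ0 : 0 < β) (hβ1 : β ≤ 1) :
    (fun x : ℝ =>
        ((x ^ (-β) : ℝ) : ℂ) *
          ((1 - Complex.exp (-(x : ℂ))) ^ (β : ℂ) *
            (((1 + β / 2 : ℝ) : ℂ) - ((β / 2 : ℝ) : ℂ) * Complex.exp (-(x : ℂ))))
        - 1 + ((β * (3 * β + 5) / 24 : ℝ) : ℂ) * (x : ℂ) ^ 2)
      =O[nhdsWithin 0 (Set.Ioi 0)] (fun x : ℝ => x ^ 3) := by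
  refine IsBigO.congr' (f₁ := fun x : ℝ => ((((1 - exp (-x)) / x) ^ β *
    ((1 + β / 2) - β / 2 * exp (-x)) - 1 + β * (3 * β + 5) / 24 * x ^ 2 : ℝ) : ℂ))
    (.of_norm_left ?_) ?_ .rfl
  · simpa only [Complex.norm_real] using (rpow_neg_mul_generating_function_isBigO β).norm_left
  · filter_upwards [self_mem_nhdsWithin] with x hx
    have hx0 : (0 : ℝ) < x := hx
    have hs : 0 ≤ 1 - exp (-x) := by
      have := Real.exp_le_one_iff.mpr (neg_nonpos.mpr hx0.le)
      linarith
    have hpow : (1 - Complex.exp (-(x : ℂ))) ^ (β : ℂ) = (((1 - exp (-x)) ^ β : ℝ) : ℂ) := by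
      rw [Complex.ofReal_cpow hs]
      simp
    rw [hpow, Real.div_rpow hs hx0.le, Real.rpow_neg hx0.le]
    push_cast
    ring
end

section
/- Let 0 < β ≤ 1 and define δ(ξ) = (1-ξ)^β · ((1+β/2) - (β/2)ξ) using principal complex powers. Then for every θ with 0 < θ < π, the real part of δ(e^{iθ}) is strictly positive. By the conjugation symmetry δ(conj ξ) = conj δ(ξ), the same holds for -π < θ < 0. -/
open Real

/-- Positivity of the trigonometric factor governing the real part. -/
lemma cos_mul_add_mul_cos_mul_cos_pos {β φ : ℝ} (hβ0 : 0 < β) (hβ1 : β ≤ 1)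
    (hφ0 : 0 < φ) (hφ : φ < π / 2) :
    0 < cos (β * φ) + β * (cos φ * cos (β * φ + φ)) := by
  have hβφ : β * φ ≤ φ := mul_le_of_le_one_left hφ0.le hβ1
  have hβφ0 : 0 < β * φ := mul_pos hβ0 hφ0
  have hc : 0 < cos φ := cos_pos_of_mem_Ioo ⟨by linarith, hφ⟩
  have hle : cos φ ≤ cos (β * φ) := cos_le_cos_of_nonneg_of_le_pi hβφ0.le (by linarith) hβφ
  have hlt : -1 < cos (β * φ + φ) := by
    rw [← cos_pi]
    exact cos_lt_cos_of_nonneg_of_le_pi (by linarith) le_rfl (by linarith)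
  have h1 : -cos φ < cos φ * cos (β * φ + φ) := by nlinarith
  nlinarith

/-- The real part in the half-angle coordinate `φ`, where `ξ = -exp (-2 φ I)`. -/
lemma re_one_add_exp_cpow_mul (β : ℝ) {φ : ℝ} (h1 : -(π / 2) < φ) (h2 : φ < π / 2) :
    ((1 + Complex.exp (((-(2 * φ) : ℝ) : ℂ) * Complex.I)) ^ (β : ℂ) *
      (((1 + β / 2 : ℝ) : ℂ) +
        ((β / 2 : ℝ) : ℂ) * Complex.exp (((-(2 * φ) : ℝ) : ℂ) * Complex.I))).re =
      (2 * cos φ) ^ β * (cos (β * φ) + β * (cos φ * cos (β * φ + φ))) := by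
  have hc : 0 < 2 * cos φ := mul_pos two_pos (cos_pos_of_mem_Ioo ⟨h1, h2⟩)
  have hbase : 1 + Complex.exp (((-(2 * φ) : ℝ) : ℂ) * Complex.I) =
      ((2 * cos φ : ℝ) : ℂ) * Complex.exp (((-φ : ℝ) : ℂ) * Complex.I) := by
    apply Complex.ext
    · rw [Complex.re_ofReal_mul, Complex.add_re, Complex.exp_ofReal_mul_I_re,
        Complex.exp_ofReal_mul_I_re, cos_neg, cos_neg, cos_two_mul, Complex.one_re]
      ring
    · rw [Complex.im_ofReal_mul, Complex.add_im, Complex.exp_ofReal_mul_I_im,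
        Complex.exp_ofReal_mul_I_im, sin_neg, sin_neg, sin_two_mul, Complex.one_im]
      ring
  have hpow : (1 + Complex.exp (((-(2 * φ) : ℝ) : ℂ) * Complex.I)) ^ (β : ℂ) =
      (((2 * cos φ) ^ β : ℝ) : ℂ) * Complex.exp (((-(β * φ) : ℝ) : ℂ) * Complex.I) := by
    rw [hbase, Complex.cpow_def_of_ne_zero
      (mul_ne_zero (Complex.ofReal_ne_zero.2 hc.ne') (Complex.exp_ne_zero _)),
      Complex.log_ofReal_mul hc (Complex.exp_ne_zero _), Complex.log_exp
        (by simp; linarith [pi_pos]) (by simp; linarith [pi_pos]), rpow_def_of_pos hc,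
      Complex.ofReal_exp, ← Complex.exp_add]
    congr 1
    push_cast
    ring
  rw [hpow, mul_assoc, Complex.re_ofReal_mul, Complex.mul_re, Complex.add_re, Complex.add_im,
    Complex.re_ofReal_mul, Complex.im_ofReal_mul, Complex.exp_ofReal_mul_I_re,
    Complex.exp_ofReal_mul_I_im, Complex.exp_ofReal_mul_I_re, Complex.exp_ofReal_mul_I_im,
    Complex.ofReal_re, Complex.ofReal_im, cos_neg, cos_neg, sin_neg, sin_neg, cos_two_mul,
    sin_two_mul, cos_add]
  ring

/-- Positivity of the real part in the half-angle coordinate. -/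
lemma re_one_add_exp_cpow_mul_pos {β φ : ℝ} (hβ0 : 0 < β) (hβ1 : β ≤ 1) (hφ0 : φ ≠ 0)
    (h1 : -(π / 2) < φ) (h2 : φ < π / 2) :
    0 < ((1 + Complex.exp (((-(2 * φ) : ℝ) : ℂ) * Complex.I)) ^ (β : ℂ) *
      (((1 + β / 2 : ℝ) : ℂ) +
        ((β / 2 : ℝ) : ℂ) * Complex.exp (((-(2 * φ) : ℝ) : ℂ) * Complex.I))).re := by
  rw [re_one_add_exp_cpow_mul β h1 h2]
  refine mul_pos (rpow_pos_of_pos (mul_pos two_pos (cos_pos_of_mem_Ioo ⟨h1, h2⟩)) _) ?_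
  rcases hφ0.lt_or_gt with h | h
  · have := cos_mul_add_mul_cos_mul_cos_pos hβ0 hβ1 (neg_pos.2 h) (by linarith)
    rwa [mul_neg, ← neg_add, cos_neg, cos_neg, cos_neg] at this
  · exact cos_mul_add_mul_cos_mul_cos_pos hβ0 hβ1 h h2

theorem stmt_7 (β : ℝ) (hβ0 : 0 < β) (hβ1 : β ≤ 1) :
    (∀ θ : ℝ, 0 < θ → θ < π →
        0 < ((1 - Complex.exp (θ * Complex.I)) ^ (β : ℂ) *
            (((1 + β / 2 : ℝ) : ℂ) - ((β / 2 : ℝ) : ℂ) * Complex.exp (θ * Complex.I))).re) ∧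
      ∀ θ : ℝ, -π < θ → θ < 0 →
        0 < ((1 - Complex.exp (θ * Complex.I)) ^ (β : ℂ) *
            (((1 + β / 2 : ℝ) : ℂ) - ((β / 2 : ℝ) : ℂ) * Complex.exp (θ * Complex.I))).re := by
  constructor
  · intro θ h0 hπ
    have h := re_one_add_exp_cpow_mul_pos (φ := (π - θ) / 2) hβ0 hβ1
      (by linarith : 0 < (π - θ) / 2).ne' (by linarith) (by linarith)
    have he : Complex.exp (((-(2 * ((π - θ) / 2)) : ℝ) : ℂ) * Complex.I) =
        -Complex.exp (θ * Complex.I) := by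
      rw [← Complex.exp_sub_pi_mul_I]
      congr 1
      push_cast
      ring
    rwa [he, mul_neg, ← sub_eq_add_neg, ← sub_eq_add_neg] at h
  · intro θ hπ h0
    have h := re_one_add_exp_cpow_mul_pos (φ := (-π - θ) / 2) hβ0 hβ1
      (by linarith : (-π - θ) / 2 < 0).ne (by linarith) (by linarith)
    have he : Complex.exp (((-(2 * ((-π - θ) / 2)) : ℝ) : ℂ) * Complex.I) =
        -Complex.exp (θ * Complex.I) := by
      rw [← Complex.exp_add_pi_mul_I]
      congr 1
      push_cast
      ring
    rwa [he, mul_neg, ← sub_eq_add_neg, ← sub_eq_add_neg] at h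
end

section
/- Let 0 < β ≤ 1 and define δ(ξ) = (1-ξ)^β · ((1+β/2) - (β/2)ξ) using principal complex powers. Then for every θ with 0 < θ < π, the imaginary part of δ(e^{iθ}) is strictly negative. By the conjugation symmetry δ(conj ξ) = conj δ(ξ), the imaginary part of δ(e^{iθ}) is strictly positive for -π < θ < 0. -/
open Real

/-- For `0 < β ≤ 1`, the function `z ↦ z ^ β * (1 + (β / 2) z)` maps the open fourth quadrant
into the lower half-plane. -/
lemma im_cpow_mul_one_add_neg {β : ℝ} (hβ0 : 0 < β) (hβ1 : β ≤ 1) {z : ℂ}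
    (hre : 0 < z.re) (him : z.im < 0) :
    (z ^ (β : ℂ) * (1 + ((β / 2 : ℝ) : ℂ) * z)).im < 0 := by
  have hz : z ≠ 0 := fun h => by simp [h] at hre
  have harg : z.arg < 0 := Complex.arg_neg_iff.2 him
  have hlow : -(π / 2) < z.arg :=
    (abs_lt.1 (Complex.abs_arg_lt_pi_div_two_iff.2 (Or.inl hre))).1
  have hneg : z.arg * β < 0 := mul_neg_of_neg_of_pos harg hβ0
  have hgt : -(π / 2) < z.arg * β := by nlinarith
  have hsin : Real.sin (z.arg * β) < 0 :=
    Real.sin_neg_of_neg_of_neg_pi_lt hneg (by linarith [Real.pi_pos])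
  have hcos : 0 < Real.cos (z.arg * β) :=
    Real.cos_pos_of_mem_Ioo ⟨hgt, by linarith [Real.pi_pos]⟩
  have hnorm : 0 < ‖z‖ ^ β := Real.rpow_pos_of_pos (norm_pos_iff.2 hz) β
  have him_eq : (z ^ (β : ℂ) * (1 + ((β / 2 : ℝ) : ℂ) * z)).im =
      ‖z‖ ^ β * (Real.cos (z.arg * β) * (β / 2 * z.im) +
        Real.sin (z.arg * β) * (1 + β / 2 * z.re)) := by
    rw [Complex.cpow_ofReal]
    simp only [Complex.mul_im, Complex.mul_re, Complex.add_re, Complex.add_im, Complex.ofReal_re,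
      Complex.ofReal_im, Complex.I_re, Complex.I_im, Complex.one_re, Complex.one_im]
    ring
  rw [him_eq]
  refine mul_neg_of_pos_of_neg hnorm (add_neg ?_ ?_)
  · exact mul_neg_of_pos_of_neg hcos (mul_neg_of_pos_of_neg (by positivity) him)
  · exact mul_neg_of_neg_of_pos hsin (by positivity)

lemma im_one_sub_exp_cpow_mul_neg {β : ℝ} (hβ0 : 0 < β) (hβ1 : β ≤ 1) {θ : ℝ}
    (hθ0 : 0 < θ) (hθπ : θ < π) :
    ((1 - Complex.exp (θ * Complex.I)) ^ (β : ℂ) *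
      (((1 + β / 2 : ℝ) : ℂ) - ((β / 2 : ℝ) : ℂ) * Complex.exp (θ * Complex.I))).im < 0 := by
  have hsin : 0 < Real.sin θ := Real.sin_pos_of_pos_of_lt_pi hθ0 hθπ
  have hcos : Real.cos θ < 1 := by nlinarith [Real.sin_sq_add_cos_sq θ]
  have h := im_cpow_mul_one_add_neg hβ0 hβ1 (z := 1 - Complex.exp (θ * Complex.I))
    (by simpa [Complex.exp_ofReal_mul_I_re] using hcos)
    (by simpa [Complex.exp_ofReal_mul_I_im] using hsin)
  convert h using 3
  push_cast
  ring

/-- Conjugation symmetry `δ (conj ξ) = conj (δ ξ)` at `ξ = exp (θ * I)`. -/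
lemma one_sub_exp_neg_cpow_mul {θ : ℝ} (hθ0 : 0 < θ) (hθπ : θ < π) (β : ℝ) :
    (1 - Complex.exp ((-θ : ℝ) * Complex.I)) ^ (β : ℂ) *
      (((1 + β / 2 : ℝ) : ℂ) - ((β / 2 : ℝ) : ℂ) * Complex.exp ((-θ : ℝ) * Complex.I)) =
    (starRingEnd ℂ) ((1 - Complex.exp (θ * Complex.I)) ^ (β : ℂ) *
      (((1 + β / 2 : ℝ) : ℂ) - ((β / 2 : ℝ) : ℂ) * Complex.exp (θ * Complex.I))) := by
  have hsin : 0 < Real.sin θ := Real.sin_pos_of_pos_of_lt_pi hθ0 hθπ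
  have harg : (1 - Complex.exp (θ * Complex.I)).arg ≠ π := by
    intro h
    have him := (Complex.arg_eq_pi_iff.1 h).2
    simp [Complex.exp_ofReal_mul_I_im] at him
    exact hsin.ne' him
  have hexp : Complex.exp ((-θ : ℝ) * Complex.I) =
      (starRingEnd ℂ) (Complex.exp (θ * Complex.I)) := by
    rw [← Complex.exp_conj]
    simp
  have hpow := Complex.conj_cpow (1 - Complex.exp (θ * Complex.I)) (β : ℂ) harg
  rw [Complex.conj_ofReal, map_sub, map_one] at hpow
  rw [hexp, map_mul, map_sub, map_mul, Complex.conj_ofReal, Complex.conj_ofReal, hpow]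

theorem stmt_8 (β : ℝ) (hβ0 : 0 < β) (hβ1 : β ≤ 1) :
    (∀ θ : ℝ, 0 < θ → θ < π →
        ((1 - Complex.exp (θ * Complex.I)) ^ (β : ℂ) *
            (((1 + β / 2 : ℝ) : ℂ) - ((β / 2 : ℝ) : ℂ) * Complex.exp (θ * Complex.I))).im < 0) ∧
      ∀ θ : ℝ, -π < θ → θ < 0 →
        0 < ((1 - Complex.exp (θ * Complex.I)) ^ (β : ℂ) *
            (((1 + β / 2 : ℝ) : ℂ) - ((β / 2 : ℝ) : ℂ) * Complex.exp (θ * Complex.I))).im := by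
  refine ⟨fun θ hθ0 hθπ => im_one_sub_exp_cpow_mul_neg hβ0 hβ1 hθ0 hθπ, fun θ hθπ hθ0 => ?_⟩
  have hpos : 0 < -θ := by linarith
  have hlt : -θ < π := by linarith
  have hconj := one_sub_exp_neg_cpow_mul hpos hlt β
  rw [neg_neg] at hconj
  rw [hconj, Complex.conj_im]
  exact neg_pos.2 (im_one_sub_exp_cpow_mul_neg hβ0 hβ1 hpos hlt)
end

section
/- Let 0 < β ≤ 1 and for θ ∈ [0, π] set φ(θ) = θ/2 - π/2 and g(θ) = (1+β/2)·cos(β φ(θ)) + (β/2)·cos((β+2) φ(θ)). Then g(0) = cos(βπ/2), g is strictly increasing on [0, π], and consequently g(θ) > 0 for all θ ∈ (0, π]. -/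
open Real

theorem stmt_9 (β : ℝ) (hβ0 : 0 < β) (hβ1 : β ≤ 1)
    (φ g : ℝ → ℝ) (hφ : ∀ θ, φ θ = θ / 2 - π / 2)
    (hg : ∀ θ, g θ = (1 + β / 2) * Real.cos (β * φ θ) + β / 2 * Real.cos ((β + 2) * φ θ)) :
    g 0 = Real.cos (β * π / 2) ∧
      StrictMonoOn g (Set.Icc 0 π) ∧
      ∀ θ ∈ Set.Ioc (0 : ℝ) π, 0 < g θ := by
  have g_zero : g 0 = Real.cos (β * π / 2) := by
    have h₁ : β * (0 / 2 - π / 2) = -(β * π / 2) := by ring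
    have h₂ : (β + 2) * (0 / 2 - π / 2) = -(β * π / 2 + π) := by ring
    rw [hg, hφ, h₁, h₂, cos_neg, cos_neg, cos_add_pi]
    ring
  have hasDeriv_g (θ : ℝ) :
      HasDerivAt g (β * (1 + β / 2) * (sin ((β + 1) * (π / 2 - θ / 2)) * cos (π / 2 - θ / 2))) θ := by
    have hφ' : HasDerivAt φ (1 / 2) θ := by
      rw [funext hφ]
      exact ((hasDerivAt_id θ).div_const 2).sub_const _
    have h := ((hφ'.const_mul β).cos.const_mul (1 + β / 2)).add
      ((hφ'.const_mul (β + 2)).cos.const_mul (β / 2))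
    rw [funext hg]
    refine h.congr_deriv ?_
    have h₁ : π / 2 - θ / 2 = -φ θ := by rw [hφ]; ring
    have h₂ : β * φ θ = (β + 1) * φ θ - φ θ := by ring
    have h₃ : (β + 2) * φ θ = (β + 1) * φ θ + φ θ := by ring
    rw [h₁, mul_neg, sin_neg, cos_neg, h₂, h₃, sin_sub, sin_add]
    ring
  have g_mono : StrictMonoOn g (Set.Icc 0 π) := by
    refine strictMonoOn_of_deriv_pos (convex_Icc 0 π)
      (fun θ _ => (hasDeriv_g θ).continuousAt.continuousWithinAt) fun θ hθ => ?_
    rw [interior_Icc] at hθ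
    obtain ⟨h0, hπ⟩ := hθ
    rw [(hasDeriv_g θ).deriv]
    have hsin : 0 < sin ((β + 1) * (π / 2 - θ / 2)) :=
      sin_pos_of_pos_of_lt_pi (mul_pos (by linarith) (by linarith)) (by nlinarith)
    have hcos : 0 < cos (π / 2 - θ / 2) :=
      cos_pos_of_mem_Ioo ⟨by linarith, by linarith⟩
    positivity
  refine ⟨g_zero, g_mono, fun θ hθ => ?_⟩
  have hcos : 0 ≤ g 0 := by
    rw [g_zero]
    exact cos_nonneg_of_mem_Icc ⟨by nlinarith [pi_pos], by nlinarith [pi_pos]⟩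
  exact hcos.trans_lt (g_mono ⟨le_rfl, pi_pos.le⟩ ⟨hθ.1.le, hθ.2⟩ hθ.1)
end

section
/- Let 0 < β ≤ 1 and for θ ∈ [0, π] set φ(θ) = θ/2 - π/2, g(θ) = (1+β/2)·cos(β φ(θ)) + (β/2)·cos((β+2) φ(θ)), and h(θ) = sin(β φ(θ)) + β cos(φ(θ)) sin((β+1) φ(θ)). Then the quotient θ ↦ h(θ)/g(θ) is strictly increasing on (0, π), and its derivative equals β(β+1)(β+2) cos²(φ(θ)) / (2 g(θ)²) at every θ ∈ (0, π). -/
open Real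

/-- The denominator is positive for `0 ≤ x < π / 2`. -/
lemma denominator_pos_of_nonneg {β x : ℝ} (hβ0 : 0 < β) (hβ1 : β ≤ 1) (hx0 : 0 ≤ x)
    (hx : x < π / 2) :
    0 < (1 + β / 2) * cos (β * x) + β / 2 * cos ((β + 2) * x) := by
  have hβx : 0 ≤ β * x := by positivity
  have hle : β * x ≤ x := mul_le_of_le_one_left hx0 hβ1
  have hcos : 0 < cos x := cos_pos_of_mem_Ioo ⟨by linarith, hx⟩
  have hsin : 0 ≤ sin x := sin_nonneg_of_nonneg_of_le_pi hx0 (by linarith)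
  have hcos_le : cos x ≤ cos (β * x) := cos_le_cos_of_nonneg_of_le_pi hβx (by linarith) hle
  have hsin_le : sin (β * x) ≤ sin x :=
    sin_le_sin_of_le_of_le_pi_div_two (by linarith) hx.le hle
  have hsq := sin_sq_add_cos_sq x
  have hrw : (1 + β / 2) * cos (β * x) + β / 2 * cos ((β + 2) * x) =
      cos (β * x) * (1 + β * cos x ^ 2) - β * (sin x * cos x) * sin (β * x) := by
    rw [add_mul β 2 x, cos_add, cos_two_mul, sin_two_mul]
    ring
  have h₁ : cos x * (1 + β * cos x ^ 2) ≤ cos (β * x) * (1 + β * cos x ^ 2) := by gcongr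
  have h₂ : β * (sin x * cos x) * sin (β * x) ≤ β * (sin x * cos x) * sin x := by gcongr
  have h₃ : 0 < cos x * ((1 - β) * sin x ^ 2 + (1 + β) * cos x ^ 2) :=
    mul_pos hcos (add_pos_of_nonneg_of_pos (mul_nonneg (by linarith) (sq_nonneg _))
      (by positivity))
  rw [hrw]
  linear_combination h₁ + h₂ + h₃ + cos x * hsq

lemma denominator_pos {β x : ℝ} (hβ0 : 0 < β) (hβ1 : β ≤ 1) (hx : |x| < π / 2) :
    0 < (1 + β / 2) * cos (β * x) + β / 2 * cos ((β + 2) * x) := by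
  rcases abs_cases x with ⟨h, -⟩ | ⟨h, -⟩
  · exact denominator_pos_of_nonneg hβ0 hβ1 (h ▸ abs_nonneg x) (h ▸ hx)
  · simpa using denominator_pos_of_nonneg (x := -x) hβ0 hβ1 (h ▸ abs_nonneg x) (h ▸ hx)

lemma hasDerivAt_quotient {β x : ℝ}
    (hne : (1 + β / 2) * cos (β * x) + β / 2 * cos ((β + 2) * x) ≠ 0) :
    HasDerivAt (fun y => (sin (β * y) + β * cos y * sin ((β + 1) * y)) /
        ((1 + β / 2) * cos (β * y) + β / 2 * cos ((β + 2) * y)))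
      (β * (β + 1) * (β + 2) * cos x ^ 2 /
        ((1 + β / 2) * cos (β * x) + β / 2 * cos ((β + 2) * x)) ^ 2) x := by
  have hnum : (fun y => sin (β * y) + β * cos y * sin ((β + 1) * y)) =
      fun y => (1 + β / 2) * sin (β * y) + β / 2 * sin ((β + 2) * y) := by
    funext y
    have e₁ : (β + 2) * y = (β + 1) * y + y := by ring
    have e₂ : β * y = (β + 1) * y - y := by ring
    rw [e₁, e₂, sin_add, sin_sub]
    ring
  have hlin (c : ℝ) : HasDerivAt (fun y : ℝ => c * y) c x := by
    simpa using (hasDerivAt_id x).const_mul c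
  have hN := (((hlin β).sin.const_mul (1 + β / 2)).add
    ((hlin (β + 2)).sin.const_mul (β / 2)))
  have hD := (((hlin β).cos.const_mul (1 + β / 2)).add
    ((hlin (β + 2)).cos.const_mul (β / 2)))
  have hQ := hN.div hD hne
  have hfun : (fun y => (sin (β * y) + β * cos y * sin ((β + 1) * y)) /
      ((1 + β / 2) * cos (β * y) + β / 2 * cos ((β + 2) * y))) =
      fun y => ((1 + β / 2) * sin (β * y) + β / 2 * sin ((β + 2) * y)) /
        ((1 + β / 2) * cos (β * y) + β / 2 * cos ((β + 2) * y)) :=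
    funext fun y => congrArg (· / _) (congrFun hnum y)
  rw [hfun]
  refine hQ.congr_deriv (congrArg₂ (· / ·) ?_ rfl)
  have hA := sin_sq_add_cos_sq (β * x)
  have hB := sin_sq_add_cos_sq ((β + 2) * x)
  have hdiff : cos ((β + 2) * x) * cos (β * x) + sin ((β + 2) * x) * sin (β * x) =
      2 * cos x ^ 2 - 1 := by
    rw [← cos_sub, ← cos_two_mul]
    ring_nf
  simp only [Pi.add_apply]
  linear_combination (β * (β + 2) / 2) * ((1 + β / 2) * hA + β / 2 * hB + (1 + β) * hdiff)

theorem stmt_10 (β : ℝ) (hβ0 : 0 < β) (hβ1 : β ≤ 1)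
    (φ g h : ℝ → ℝ) (hφ : ∀ θ, φ θ = θ / 2 - π / 2)
    (hg : ∀ θ, g θ = (1 + β / 2) * Real.cos (β * φ θ) + β / 2 * Real.cos ((β + 2) * φ θ))
    (hh : ∀ θ, h θ = Real.sin (β * φ θ) + β * Real.cos (φ θ) * Real.sin ((β + 1) * φ θ)) :
    StrictMonoOn (fun θ => h θ / g θ) (Set.Ioo 0 π) ∧
      ∀ θ ∈ Set.Ioo (0 : ℝ) π,
        HasDerivAt (fun θ => h θ / g θ)
          (β * (β + 1) * (β + 2) * Real.cos (φ θ) ^ 2 / (2 * g θ ^ 2)) θ := by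
  have hφ_abs : ∀ θ ∈ Set.Ioo (0 : ℝ) π, |φ θ| < π / 2 := by
    rintro θ ⟨h0, hπ⟩
    rw [hφ, abs_lt]
    constructor <;> linarith
  have hg_pos : ∀ θ ∈ Set.Ioo (0 : ℝ) π, 0 < g θ := fun θ hθ => by
    rw [hg]
    exact denominator_pos hβ0 hβ1 (hφ_abs θ hθ)
  have hderiv : ∀ θ ∈ Set.Ioo (0 : ℝ) π, HasDerivAt (fun θ => h θ / g θ)
      (β * (β + 1) * (β + 2) * Real.cos (φ θ) ^ 2 / (2 * g θ ^ 2)) θ := fun θ hθ => by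
    have hφ' : HasDerivAt φ (1 / 2) θ := by
      rw [funext hφ]
      exact ((hasDerivAt_id θ).div_const 2).sub_const _
    have hne := (hg_pos θ hθ).ne'
    have hcomp := (hasDerivAt_quotient (hg θ ▸ hne)).comp θ hφ'
    rw [← hg] at hcomp
    have hfun : (fun θ => h θ / g θ) =
        (fun y => (sin (β * y) + β * cos y * sin ((β + 1) * y)) /
          ((1 + β / 2) * cos (β * y) + β / 2 * cos ((β + 2) * y))) ∘ φ := by
      funext t
      rw [hh, hg, Function.comp_apply]
    rw [hfun]
    refine hcomp.congr_deriv ?_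
    field_simp
  refine ⟨strictMonoOn_of_deriv_pos (convex_Ioo 0 π)
    (fun θ hθ => (hderiv θ hθ).continuousAt.continuousWithinAt) fun θ hθ => ?_, hderiv⟩
  rw [interior_Ioo] at hθ
  rw [(hderiv θ hθ).deriv]
  have hg' := hg_pos θ hθ
  have hcos : 0 < cos (φ θ) := cos_pos_of_mem_Ioo (abs_lt.mp (hφ_abs θ hθ) |>.imp
    (fun h => by linarith) id)
  positivity
end

section
/- Let 0 < β < 1 and for θ ∈ (0, π) set φ(θ) = θ/2 - π/2, g(θ) = (1+β/2)·cos(β φ(θ)) + (β/2)·cos((β+2) φ(θ)), and h(θ) = sin(β φ(θ)) + β cos(φ(θ)) sin((β+1) φ(θ)). Then h(0)/g(0) = -tan(βπ/2), and for every θ ∈ (0, π) one has h(θ)/g(θ) > -tan(βπ/2). -/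
open Real

theorem mul_sin_add_two_mul_lt {β x : ℝ} (hβ0 : 0 < β) (hβ1 : β < 1) (hx0 : 0 < x)
    (hx : x < π / 2) : β * sin ((β + 2) * x) < (β + 2) * sin (β * x) := by
  have hderiv : ∀ y : ℝ, HasDerivAt
      (fun y => (β + 2) * sin (β * y) - β * sin ((β + 2) * y))
      ((β + 2) * (cos (β * y) * β) - β * (cos ((β + 2) * y) * (β + 2))) y := fun y =>
    ((hasDerivAt_const_mul β).sin.const_mul (β + 2)).sub
      ((hasDerivAt_const_mul (β + 2)).sin.const_mul β)
  have hmono : StrictMonoOn (fun y => (β + 2) * sin (β * y) - β * sin ((β + 2) * y))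
      (Set.Icc 0 (π / 2)) := by
    refine strictMonoOn_of_deriv_pos (convex_Icc _ _) (by fun_prop) fun y hy => ?_
    rw [interior_Icc] at hy
    obtain ⟨hy0, hy1⟩ := hy
    rw [(hderiv y).deriv]
    have hcos : cos ((β + 2) * y) < cos (β * y) := by
      have h1 : 0 < sin ((β + 1) * y) := sin_pos_of_pos_of_lt_pi (by positivity) (by nlinarith)
      have h2 : 0 < sin y := sin_pos_of_pos_of_lt_pi hy0 (by linarith)
      have e1 : (β + 2) * y = (β + 1) * y + y := by ring
      have e2 : β * y = (β + 1) * y - y := by ring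
      rw [e1, e2, cos_add, cos_sub]
      linarith [mul_pos h1 h2]
    have hpos : 0 < β * (β + 2) := by positivity
    nlinarith [mul_pos hpos (sub_pos.2 hcos)]
  have := hmono (Set.left_mem_Icc.2 (by positivity)) ⟨hx0.le, hx.le⟩ hx0
  simp only [mul_zero, sin_zero, sub_self] at this
  linarith

theorem add_mul_cos_pos {β x : ℝ} (hβ0 : 0 < β) (hβ1 : β < 1) (hx0 : 0 < x)
    (hx : x < π / 2) :
    0 < (1 + β / 2) * cos (β * x) + β / 2 * cos ((β + 2) * x) := by
  have hlt : β * x < x := by nlinarith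
  have hβx : 0 < β * x := by positivity
  have hc : 0 < cos x := cos_pos_of_mem_Ioo ⟨by linarith, hx⟩
  have hs : 0 < sin x := sin_pos_of_pos_of_lt_pi hx0 (by linarith)
  have hcos : cos x < cos (β * x) := cos_lt_cos_of_nonneg_of_le_pi_div_two hβx.le hx.le hlt
  have hsin : sin (β * x) < sin x := sin_lt_sin_of_lt_of_le_pi_div_two (by linarith) hx.le hlt
  have e : (β + 2) * x = β * x + 2 * x := by ring
  rw [e, cos_add, cos_two_mul, sin_two_mul]
  have h1 : cos x * (1 + β * cos x ^ 2) < cos (β * x) * (1 + β * cos x ^ 2) :=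
    mul_lt_mul_of_pos_right hcos (by positivity)
  have h2 : sin (β * x) * (β * sin x * cos x) < sin x * (β * sin x * cos x) :=
    mul_lt_mul_of_pos_right hsin (by positivity)
  have h3 : 0 < cos x * (1 + β * cos x ^ 2 - β * sin x ^ 2) :=
    mul_pos hc (by nlinarith [sin_sq_add_cos_sq x, sq_nonneg (cos x)])
  linarith

theorem stmt_11 (β : ℝ) (hβ0 : 0 < β) (hβ1 : β < 1)
    (φ g h : ℝ → ℝ) (hφ : ∀ θ, φ θ = θ / 2 - π / 2)
    (hg : ∀ θ, g θ = (1 + β / 2) * Real.cos (β * φ θ) + β / 2 * Real.cos ((β + 2) * φ θ))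
    (hh : ∀ θ, h θ = Real.sin (β * φ θ) + β * Real.cos (φ θ) * Real.sin ((β + 1) * φ θ)) :
    h 0 / g 0 = -Real.tan (β * π / 2) ∧
      ∀ θ ∈ Set.Ioo (0 : ℝ) π, -Real.tan (β * π / 2) < h θ / g θ := by
  constructor
  · have hφ0 : φ 0 = -(π / 2) := by rw [hφ]; ring
    have e1 : β * -(π / 2) = -(β * π / 2) := by ring
    have e2 : (β + 2) * -(π / 2) = -(β * π / 2 + π) := by ring
    have hg0 : g 0 = cos (β * π / 2) := by
      rw [hg, hφ0, e1, e2, cos_neg, cos_neg, cos_add_pi]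
      ring
    have hh0 : h 0 = -sin (β * π / 2) := by
      rw [hh, hφ0, e1, sin_neg, cos_neg, cos_pi_div_two]
      ring
    rw [hg0, hh0, tan_eq_sin_div_cos, neg_div]
  · rintro θ ⟨hθ0, hθπ⟩
    have hgpos : 0 < g θ := by
      have := add_mul_cos_pos (x := -φ θ) hβ0 hβ1 (by rw [hφ]; linarith) (by rw [hφ]; linarith)
      rwa [mul_neg, mul_neg, cos_neg, cos_neg, ← hg] at this
    have hcpos : 0 < cos (β * π / 2) :=
      cos_pos_of_mem_Ioo ⟨by nlinarith [pi_pos], by nlinarith [pi_pos]⟩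
    have hhsum : h θ = (1 + β / 2) * sin (β * φ θ) + β / 2 * sin ((β + 2) * φ θ) := by
      have e1 : β * φ θ = (β + 1) * φ θ - φ θ := by ring
      have e2 : (β + 2) * φ θ = (β + 1) * φ θ + φ θ := by ring
      rw [hh, e1, e2, sin_add, sin_sub]
      ring
    have hkey := mul_sin_add_two_mul_lt (x := θ / 2) hβ0 hβ1 (by linarith) (by linarith)
    have e1 : β * (θ / 2) = β * φ θ + β * π / 2 := by rw [hφ]; ring
    have e2 : (β + 2) * (θ / 2) = (β + 2) * φ θ + β * π / 2 + π := by rw [hφ]; ring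
    rw [e1, e2, sin_add_pi, sin_add, sin_add] at hkey
    rw [tan_eq_sin_div_cos, ← neg_div, div_lt_div_iff₀ hcpos hgpos, hhsum, hg]
    linarith
end
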